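/- arXiv:2406.17597 — 4 statements merged into one kernel-verified Lean document; each statement's English description precedes it below -/
import Mathlib

section
/- Let σ be a permutation of the finite set Fin n, P ∈ ℝ^{n×n} its permutation matrix, K a positive integer with P^K = I, and define P₀ := (1/K)·(P + P² + ⋯ + P^K). Then the column space of P₀ (the range of the linear map x ↦ P₀·x) equals the eigenspace of P for eigenvalue 1, i.e., equals {x ∈ ℝ^n : P·x = x}, the kernel of I − P. -/
theorem one_sub_mul_sum_Icc_pow_eq_zero {R : Type*} [Ring R] {x : R} {K : ℕ}
    (hx : x ^ K = 1) : (1 - x) * ∑ k ∈ Finset.Icc 1 K, x ^ k = 0 := by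
  have hsum : ∑ k ∈ Finset.Icc 1 K, x ^ k = (∑ k ∈ Finset.range K, x ^ k) * x := by
    rw [← Finset.Ico_add_one_right_eq_Icc, Finset.sum_Ico_eq_sum_range, Finset.sum_mul]
    simp [add_comm 1, pow_succ]
  rw [hsum, ← mul_assoc, mul_neg_geom_sum, hx, sub_self, zero_mul]

theorem Matrix.pow_mulVec_eq_self {m R : Type*} [Fintype m] [DecidableEq m] [Semiring R]
    {A : Matrix m m R} {v : m → R} (h : A.mulVec v = v) (k : ℕ) : (A ^ k).mulVec v = v := by
  induction k with
  | zero => simp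
  | succ k ih => rw [pow_succ, ← Matrix.mulVec_mulVec, h, ih]


/-- Theorem 4.5 (core content): the column space of
`P₀ = (1/K)·(P + P² + ⋯ + P^K)` equals the eigenspace of `P` for the
eigenvalue 1, i.e., the kernel of `I − P`. -/
theorem P0_range_eq_fixed_space (n : ℕ) (σ : Equiv.Perm (Fin n))
    (P : Matrix (Fin n) (Fin n) ℝ)
    (hP : ∀ i j, P i j = if i = σ j then 1 else 0)
    (K : ℕ) (hK : 0 < K) (hPK : P ^ K = 1)
    (P₀ : Matrix (Fin n) (Fin n) ℝ)
    (hP₀ : P₀ = (1 / (K : ℝ)) • ∑ k ∈ Finset.Icc 1 K, P ^ k) :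
    LinearMap.range P₀.mulVecLin = LinearMap.ker (1 - P).mulVecLin := by
  apply le_antisymm
  · rintro _ ⟨v, rfl⟩
    rw [LinearMap.mem_ker, Matrix.mulVecLin_apply, Matrix.mulVecLin_apply, Matrix.mulVec_mulVec,
      hP₀, Matrix.mul_smul, one_sub_mul_sum_Icc_pow_eq_zero hPK, smul_zero, Matrix.zero_mulVec]
  · intro v hv
    have hfix : P.mulVec v = v := by
      rw [LinearMap.mem_ker, Matrix.mulVecLin_apply, Matrix.sub_mulVec, Matrix.one_mulVec,
        sub_eq_zero] at hv
      exact hv.symm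
    have hK' : (K : ℝ) ≠ 0 := Nat.cast_ne_zero.mpr hK.ne'
    refine ⟨v, ?_⟩
    rw [Matrix.mulVecLin_apply, hP₀, Matrix.smul_mulVec, Matrix.sum_mulVec,
      Finset.sum_congr rfl fun k _ => Matrix.pow_mulVec_eq_self hfix k, Finset.sum_const,
      Nat.card_Icc, Nat.add_sub_cancel, ← Nat.cast_smul_eq_nsmul ℝ, smul_smul,
      one_div_mul_cancel hK', one_smul]
end

section
/- Let σ be a permutation of the finite set Fin n, P ∈ ℝ^{n×n} its permutation matrix, and K an even positive integer with P^K = I. Define Q₀ := (1/K)·∑_{k=1}^{K} (−1)^k·P^k. Then every diagonal entry of Q₀ is nonnegative: Q₀(i,i) ≥ 0 for all i. -/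
/-- If `A` has a left inverse `Aᵀ` and `A ^ K = 1`, then `S = ∑_{k=1}^{K} A ^ k` satisfies
`Sᵀ * S = K • S`. -/
theorem transpose_mul_sum_pow_Icc {ι : Type*} [Fintype ι] [DecidableEq ι]
    {A : Matrix ι ι ℝ} (hA : A.transpose * A = 1) {K : ℕ} (hAK : A ^ K = 1) :
    (∑ k ∈ Finset.Icc 1 K, A ^ k).transpose * (∑ k ∈ Finset.Icc 1 K, A ^ k) =
      (K : ℝ) • ∑ k ∈ Finset.Icc 1 K, A ^ k := by
  set S := ∑ k ∈ Finset.Icc 1 K, A ^ k with hS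
  have hgeom : S = A * ∑ k ∈ Finset.range K, A ^ k := by
    rw [hS, Finset.mul_sum, Finset.range_eq_Ico, ← Finset.Ico_add_one_right_eq_Icc,
      ← Finset.sum_Ico_add' (fun k => A ^ k) 0 K 1]
    exact Finset.sum_congr rfl fun k _ => pow_succ' A k
  have hfix : A * S = S := by
    have h := mul_geom_sum A K
    rw [hAK, sub_self, sub_mul, one_mul, sub_eq_zero] at h
    rw [hgeom, h, h]
  have htranspose : A.transpose * S = S := by
    nth_rewrite 1 [← hfix]
    rw [← mul_assoc, hA, one_mul]
  have hpow (k : ℕ) : A.transpose ^ k * S = S := by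
    induction k with
    | zero => simp
    | succ k ih => rw [pow_succ, mul_assoc, htranspose, ih]
  calc S.transpose * S = ∑ k ∈ Finset.Icc 1 K, A.transpose ^ k * S := by
        rw [← Finset.sum_mul]
        congr 1
        simp only [hS, Matrix.transpose_sum, Matrix.transpose_pow]
    _ = (K : ℝ) • S := by simp [hpow, Nat.cast_smul_eq_nsmul]

/-- The sum `∑_{k=1}^{K} A ^ k` over the powers of a real orthogonal matrix with `A ^ K = 1` has
nonnegative diagonal. -/
theorem sum_pow_Icc_diag_nonneg {ι : Type*} [Fintype ι] [DecidableEq ι]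
    {A : Matrix ι ι ℝ} (hA : A.transpose * A = 1) {K : ℕ} (hK : 0 < K) (hAK : A ^ K = 1)
    (i : ι) : 0 ≤ (∑ k ∈ Finset.Icc 1 K, A ^ k) i i := by
  have h := congrFun (congrFun (transpose_mul_sum_pow_Icc hA hAK) i) i
  rw [Matrix.mul_apply, Matrix.smul_apply, smul_eq_mul] at h
  refine nonneg_of_mul_nonneg_right (h ▸ Finset.sum_nonneg fun j _ => ?_)
    (Nat.cast_pos.mpr hK : (0 : ℝ) < K)
  exact mul_self_nonneg _

/-- Theorem 4.12 (diagonal part): for even `K`, the matrix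
`Q₀ = (1/K)·∑_{k=1}^{K} (−1)^k·P^k` has nonnegative diagonal entries. -/
theorem Q0_nonneg_diag (n : ℕ) (σ : Equiv.Perm (Fin n))
    (P : Matrix (Fin n) (Fin n) ℝ)
    (hP : ∀ i j, P i j = if i = σ j then 1 else 0)
    (K : ℕ) (hK : 0 < K) (hKeven : Even K) (hPK : P ^ K = 1)
    (Q₀ : Matrix (Fin n) (Fin n) ℝ)
    (hQ₀ : Q₀ = (1 / (K : ℝ)) • ∑ k ∈ Finset.Icc 1 K, ((-1 : ℝ) ^ k) • P ^ k) :
    ∀ i : Fin n, 0 ≤ Q₀ i i := by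
  intro i
  have hPP : P.transpose * P = 1 := by
    ext a b
    simp [Matrix.mul_apply, hP, Matrix.one_apply, eq_comm]
  have hA : (-P).transpose * (-P) = 1 := by simpa using hPP
  have hAK : (-P) ^ K = 1 := by rw [hKeven.neg_pow, hPK]
  have hsum : ∑ k ∈ Finset.Icc 1 K, ((-1 : ℝ) ^ k) • P ^ k =
      ∑ k ∈ Finset.Icc 1 K, (-P) ^ k :=
    Finset.sum_congr rfl fun k _ => by rw [← smul_pow, neg_one_smul]
  rw [hQ₀, hsum, Matrix.smul_apply, smul_eq_mul]
  exact mul_nonneg (by positivity) (sum_pow_Icc_diag_nonneg hA hK hAK i)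
end

section
/- Let σ be a permutation of the finite set Fin n, P ∈ ℝ^{n×n} its permutation matrix, and let the orbits (permutation cycles) of σ on Fin n be C₁, …, C_R. Define the n×R real matrix V by V(i,r) = 1/√|C_r| if i ∈ C_r and V(i,r) = 0 otherwise. Then the column space of V (the range of the linear map y ↦ V·y) equals the eigenspace of P corresponding to eigenvalue 1, i.e., equals {x ∈ ℝ^n : P·x = x}. -/
/-- A function invariant under a permutation is constant on each of its cycles. -/
theorem Equiv.Perm.SameCycle.apply_eq_of_invariant {α β : Type*} {σ : Equiv.Perm α} {f : α → β}
    (hf : ∀ i, f (σ i) = f i) {i j : α} (h : σ.SameCycle i j) : f i = f j := by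
  obtain ⟨k, rfl⟩ := h
  induction k with
  | zero => simp
  | succ k ih => rw [add_comm, zpow_add, Equiv.Perm.mul_apply, zpow_one, hf, ih]
  | pred k ih =>
    rw [ih, ← hf ((σ ^ (-(k : ℤ) - 1)) i), ← Equiv.Perm.mul_apply, ← zpow_one_add]
    congr 3
    ring

/-- The fixed vectors of a permutation matrix are the vectors invariant under the permutation. -/
theorem mulVec_eq_self_iff_invariant {ι S : Type*} [Fintype ι] [DecidableEq ι]
    [NonAssocSemiring S] {σ : Equiv.Perm ι} {P : Matrix ι ι S}
    (hP : ∀ i j, P i j = if i = σ j then 1 else 0) (x : ι → S) :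
    P.mulVec x = x ↔ ∀ i, x (σ i) = x i := by
  have hmul : ∀ i, P.mulVec x (σ i) = x i := fun i => by
    simp [Matrix.mulVec, dotProduct, hP]
  rw [funext_iff, ← σ.forall_congr_right]
  simp only [hmul, eq_comm]

/-- Theorem 5.1 (main claim): the column space of the normalized
orbit-indicator matrix `V` equals the eigenspace `{x : P·x = x}` of `P` for
the eigenvalue 1. -/
theorem orbit_indicator_range (n R : ℕ) (σ : Equiv.Perm (Fin n))
    (P : Matrix (Fin n) (Fin n) ℝ)
    (hP : ∀ i j, P i j = if i = σ j then 1 else 0)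
    (C : Fin R → Finset (Fin n))
    (hOrbit : ∀ r : Fin R, ∃ i : Fin n, ∀ j : Fin n, j ∈ C r ↔ σ.SameCycle i j)
    (hPartition : ∀ i : Fin n, ∃! r : Fin R, i ∈ C r)
    (V : Matrix (Fin n) (Fin R) ℝ)
    (hV : ∀ i r, V i r = if i ∈ C r then 1 / Real.sqrt ((C r).card) else 0) :
    Set.range V.mulVec = {x : Fin n → ℝ | P.mulVec x = x} := by
  have hmul : ∀ (y : Fin R → ℝ) i r, i ∈ C r →
      V.mulVec y i = 1 / Real.sqrt (C r).card * y r := by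
    intro y i r hi
    rw [Matrix.mulVec, dotProduct, Finset.sum_eq_single r]
    · rw [hV, if_pos hi]
    · intro s _ hs
      rw [hV, if_neg fun h => hs ((hPartition i).unique h hi), zero_mul]
    · simp
  choose c hc using hOrbit
  ext x
  rw [Set.mem_ofPred_eq, mulVec_eq_self_iff_invariant hP]
  constructor
  · rintro ⟨y, rfl⟩ i
    obtain ⟨r, hi, -⟩ := hPartition i
    have hσi : σ i ∈ C r := by
      rw [hc, Equiv.Perm.sameCycle_apply_right, ← hc]
      exact hi
    rw [hmul y i r hi, hmul y (σ i) r hσi]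
  · intro hx
    refine ⟨fun r => Real.sqrt (C r).card * x (c r), funext fun i => ?_⟩
    obtain ⟨r, hi, -⟩ := hPartition i
    have hcard : Real.sqrt (C r).card ≠ 0 :=
      (Real.sqrt_pos.2 (Nat.cast_pos.2 (Finset.card_pos.2 ⟨i, hi⟩))).ne'
    rw [hmul _ i r hi, ← mul_assoc, one_div_mul_cancel hcard, one_mul]
    exact ((hc r i).1 hi).apply_eq_of_invariant hx
end

section
/- Let σ be a permutation of the finite set Fin n, P ∈ ℝ^{n×n} its permutation matrix, K a positive integer with P^K = I, and let the orbits of σ be C₁, …, C_R. Define the n×R real matrix V by V(i,r) = 1/√|C_r| if i ∈ C_r and V(i,r) = 0 otherwise, and define P₀ := (1/K)·(P + P² + ⋯ + P^K). Then V·Vᵀ = P₀. -/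
open Matrix

/-- The sum of the powers over a full period absorbs a further factor. -/
lemma mul_sum_Icc_pow {M : Type*} [Semiring M] {a : M} {K : ℕ} (ha : a ^ K = 1) :
    a * ∑ k ∈ Finset.Icc 1 K, a ^ k = ∑ k ∈ Finset.Icc 1 K, a ^ k := by
  have hsum : ∑ k ∈ Finset.Icc 1 K, a ^ k = ∑ k ∈ Finset.range K, a ^ k := by
    rcases K with _ | K
    · simp
    · rw [Finset.sum_Icc_succ_top (by lia), ha, Finset.sum_range_succ', pow_zero,
        Finset.range_eq_Ico, Finset.sum_Ico_add' (fun k => a ^ k) 0 K 1]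
      rfl
  conv_lhs => rw [hsum]
  rw [Finset.mul_sum, Finset.range_eq_Ico]
  simp_rw [← pow_succ']
  rw [Finset.sum_Ico_add' (fun k => a ^ k) 0 K 1]
  rfl

/-- A function invariant under a permutation is constant on cycles. -/
lemma apply_eq_of_sameCycle {ι α : Type*} [Finite ι] {σ : Equiv.Perm ι} {f : ι → α}
    (hf : ∀ i, f (σ i) = f i) {i j : ι} (h : σ.SameCycle i j) : f i = f j := by
  obtain ⟨k, rfl⟩ := h.exists_nat_pow_eq
  induction k with
  | zero => simp
  | succ k ih =>
    rw [pow_succ', Equiv.Perm.mul_apply, hf]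
    exact ih ⟨k, by simp⟩

section PermutationMatrix

variable {ι : Type*} [Fintype ι] [DecidableEq ι] {σ : Equiv.Perm ι} {P : Matrix ι ι ℝ}

/-- Multiplication by a permutation matrix permutes the rows. -/
lemma permMatrix_mul_apply (hP : ∀ i j, P i j = if i = σ j then 1 else 0)
    (A : Matrix ι ι ℝ) (i j : ι) : (P * A) (σ i) j = A i j := by
  simp [Matrix.mul_apply, hP]

/-- Powers of a permutation matrix represent powers of the permutation. -/
lemma permMatrix_pow_apply (hP : ∀ i j, P i j = if i = σ j then 1 else 0)
    (k : ℕ) (i j : ι) : (P ^ k) i j = if i = (σ ^ k) j then 1 else 0 := by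
  induction k generalizing i with
  | zero => simp [Matrix.one_apply]
  | succ k ih =>
    obtain ⟨i, rfl⟩ := σ.surjective i
    rw [pow_succ', permMatrix_mul_apply hP, ih, pow_succ', Equiv.Perm.mul_apply]
    simp

/-- The average of the powers of a permutation matrix over a period has entry `1 / |c|` on each
cycle `c` and vanishes off the cycles. -/
lemma permMatrix_average_apply (hP : ∀ i j, P i j = if i = σ j then 1 else 0)
    {K : ℕ} (hK : 0 < K) (hPK : P ^ K = 1) {j : ι} {c : Finset ι}
    (hc : ∀ i, i ∈ c ↔ σ.SameCycle i j) (i : ι) :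
    ((1 / (K : ℝ)) • ∑ k ∈ Finset.Icc 1 K, P ^ k) i j = if i ∈ c then 1 / (c.card : ℝ) else 0 := by
  have hK' : (K : ℝ) ≠ 0 := by positivity
  set S := ∑ k ∈ Finset.Icc 1 K, P ^ k with hS
  have hentry (i : ι) : S i j = ∑ k ∈ Finset.Icc 1 K, if i = (σ ^ k) j then (1 : ℝ) else 0 := by
    simp [hS, Matrix.sum_apply, permMatrix_pow_apply hP]
  have hinv (i : ι) : S (σ i) j = S i j := by
    conv_lhs => rw [hS, ← mul_sum_Icc_pow hPK, permMatrix_mul_apply hP]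
  have hzero (i : ι) (hi : i ∉ c) : S i j = 0 := by
    rw [hentry]
    refine Finset.sum_eq_zero fun k _ => if_neg ?_
    rintro rfl
    exact hi ((hc _).2 (Equiv.Perm.sameCycle_pow_left.2 (.refl _ _)))
  have hcol : ∑ i, S i j = K := by
    simp_rw [hentry]
    rw [Finset.sum_comm]
    simp
  have hcard : c.card * S j j = K := by
    rw [← hcol, ← Finset.sum_subset (Finset.subset_univ c) fun i _ hi => hzero i hi,
      Finset.sum_congr rfl fun i hi =>
        apply_eq_of_sameCycle (f := fun i => S i j) hinv ((hc i).1 hi)]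
    simp
  rw [Matrix.smul_apply, smul_eq_mul]
  split_ifs with hi
  · have hc0 : (c.card : ℝ) ≠ 0 := by
      exact_mod_cast (Finset.card_pos.2 ⟨i, hi⟩).ne'
    rw [apply_eq_of_sameCycle (f := fun i => S i j) hinv ((hc i).1 hi), ← hcard]
    rw [← hcard] at hK'
    have := right_ne_zero_of_mul hK'
    field_simp
  · rw [hzero i hi, mul_zero]

end PermutationMatrix

/-- Connection between Theorem 4.5 and Theorem 5.1: the normalized
orbit-indicator matrix `V` is a square root of the covariance matrix
`P₀ = (1/K)·(P + P² + ⋯ + P^K)`, i.e., `V·Vᵀ = P₀`. -/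
theorem orbit_indicator_sqrt_P0 (n R : ℕ) (σ : Equiv.Perm (Fin n))
    (P : Matrix (Fin n) (Fin n) ℝ)
    (hP : ∀ i j, P i j = if i = σ j then 1 else 0)
    (K : ℕ) (hK : 0 < K) (hPK : P ^ K = 1)
    (C : Fin R → Finset (Fin n))
    (hOrbit : ∀ r : Fin R, ∃ i : Fin n, ∀ j : Fin n, j ∈ C r ↔ σ.SameCycle i j)
    (hPartition : ∀ i : Fin n, ∃! r : Fin R, i ∈ C r)
    (V : Matrix (Fin n) (Fin R) ℝ)
    (hV : ∀ i r, V i r = if i ∈ C r then 1 / Real.sqrt ((C r).card) else 0)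
    (P₀ : Matrix (Fin n) (Fin n) ℝ)
    (hP₀ : P₀ = (1 / (K : ℝ)) • ∑ k ∈ Finset.Icc 1 K, P ^ k) :
    V * Vᵀ = P₀ := by
  ext i j
  obtain ⟨r, hjr, hr⟩ := hPartition j
  have hc (i : Fin n) : i ∈ C r ↔ σ.SameCycle i j := by
    obtain ⟨a, ha⟩ := hOrbit r
    have haj := (ha j).1 hjr
    exact (ha i).trans ⟨fun h => h.symm.trans haj, fun h => haj.trans h.symm⟩
  rw [hP₀, permMatrix_average_apply hP hK hPK hc, Matrix.mul_apply, Finset.sum_eq_single r]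
  · rw [Matrix.transpose_apply, hV, hV, if_pos hjr]
    split_ifs
    · rw [div_mul_div_comm, Real.mul_self_sqrt (Nat.cast_nonneg _), one_mul]
    · rw [zero_mul]
  · intro s _ hs
    rw [Matrix.transpose_apply, hV j, if_neg fun hj => hs (hr s hj), mul_zero]
  · simp
end
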